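/- If a vector c = (c_1, …, c_{30}) ∈ ℚ^{30} satisfies all 49 equations (E1)–(E49) of the system S and c_1 = 0, then c = 0. Equivalently, every nonzero solution of S has c_1 ≠ 0. (This shows that the invariance constraints admit no tautological relation in codimension 3 on \bar M_{3,1} that does not involve the class ψ^3 = ⟨∂^x_3⟩_3, and that c_1 may be used as a normalization for the unique relation.) -/

import Mathlib

def SatS (c : Fin 30 → ℚ) : Prop :=
    c 1 + c 3 = 0 ∧
    3 * c 2 - c 3 + c 5 / 24 = 0 ∧
    -c 2 / 80 - c 7 + c 14 / 24 = 0 ∧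
    c 6 - c 7 - c 10 = 0 ∧
    c 2 / 30 - c 10 + c 24 / 24 = 0 ∧
    c 2 / 30 + 2 * c 7 - c 11 + c 23 / 24 = 0 ∧
    -c 2 / 30 - c 6 + c 7 + c 15 / 24 = 0 ∧
    c 13 - c 14 + c 17 - c 23 = 0 ∧
    c 14 - c 16 + c 24 = 0 ∧
    (4 / 5) * c 2 - c 15 + c 26 / 24 = 0 ∧
    -c 2 - c 5 / 240 + c 13 - c 14 = 0 ∧
    (4 / 5) * c 2 + c 13 + c 14 - c 17 + c 27 / 12 = 0 ∧
    -(4 / 5) * c 2 + c 14 - c 16 + c 26 / 24 = 0 ∧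
    c 5 / 10 + 2 * c 15 + c 21 - c 22 = 0 ∧
    (7 / 10) * c 5 + c 26 + c 27 - 3 * c 28 = 0 ∧
    -c 7 + c 8 + c 13 / 24 - c 20 = 0 ∧
    2 * c 8 - c 11 = 0 ∧
    c 2 / 48 - c 6 + c 16 / 24 = 0 ∧
    -c 2 / 24 - c 3 / 240 - c 7 + c 13 / 24 = 0 ∧
    c 2 / 48 + c 7 - 2 * c 8 + c 13 / 24 + c 17 / 24 = 0 ∧
    (7 / 30) * c 2 + 2 * c 7 - c 12 + c 22 / 24 = 0 ∧
    c 3 / 10 + 2 * c 6 - c 12 + c 21 / 24 = 0 ∧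
    (13 / 10) * c 2 + c 14 - c 18 + c 28 / 8 = 0 ∧
    (7 / 10) * c 3 + c 16 - c 18 + c 27 / 24 = 0 ∧
    (23 / 240) * c 2 + c 7 - 2 * c 9 + c 14 / 24 + c 18 / 12 = 0 ∧
    (13 / 240) * c 3 + c 6 - 2 * c 9 + c 16 / 24 + c 17 / 24 = 0 ∧
    c 5 / 960 + c 8 - c 9 + c 15 / 24 = 0 ∧
    (13 / 240) * c 5 + c 15 + c 17 - 2 * c 18 + c 26 / 24 = 0 ∧
    c 2 / 576 + c 7 / 24 + c 9 / 24 - 3 * c 29 = 0 ∧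
    c 3 / 960 + c 6 / 24 + c 8 / 24 - 3 * c 29 = 0 ∧
    -(3 / 20) * c 0 - c 1 - 2 * c 2 - 2 * c 4 - c 5 / 24 - c 15 + 2 * c 18 - c 23 + c 26 / 24 = 0 ∧
    -c 1 - c 3 = 0 ∧
    (11 / 240) * c 0 + c 1 + 2 * c 2 + c 4 - c 17 + c 23 = 0 ∧
    -c 0 / 10 - 2 * c 2 - c 4 + 4 * c 18 - c 22 - c 23 = 0 ∧
    c 0 / 10 + c 4 + c 21 - c 22 - 2 * c 24 + 2 * c 25 = 0 ∧
    -(7 / 10) * c 0 - c 5 - c 27 + 3 * c 28 = 0 ∧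
    c 0 / 20 + c 1 + c 2 + c 4 - c 13 + c 14 + c 17 - c 21 = 0 ∧
    -(11 / 240) * c 0 - c 1 - 2 * c 2 - c 4 - c 13 + c 14 = 0 ∧
    -c 0 / 2 + 4 * c 4 - c 5 / 2 = 0 ∧
    -c 0 / 40 - c 1 / 2 - c 2 / 2 - c 4 / 2 + 2 * c 7 - c 14 / 2 = 0 ∧
    c 0 / 240 - c 2 - c 4 / 60 + 4 * c 7 + 2 * c 11 - c 14 - 3 * c 20 = 0 ∧
    -c 0 / 10 - (29 / 30) * c 4 - 4 * c 10 + c 15 + 3 * c 19 - 3 * c 20 = 0 ∧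
    c 4 / 30 - 2 * c 10 + c 15 / 2 + 6 * c 20 - c 23 / 2 = 0 ∧
    c 4 / 15 + 8 * c 10 - c 15 - 3 * c 19 + 3 * c 20 = 0 ∧
    -c 4 / 30 + 4 * c 10 - c 15 / 2 - c 24 / 2 = 0 ∧
    -(7 / 5) * c 0 + (7 / 5) * c 4 - c 5 + 2 * c 22 - 2 * c 23 - 6 * c 24 + 2 * c 25 + c 26 = 0 ∧
    (4 / 5) * c 4 + 2 * c 21 + 2 * c 23 - 2 * c 24 + c 26 / 2 - c 27 = 0 ∧
    (3 / 5) * c 4 - 2 * c 22 + 2 * c 23 + 6 * c 24 + 2 * c 25 - c 26 = 0 ∧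
    -(4 / 5) * c 4 + 2 * c 15 + 2 * c 24 - c 26 = 0

theorem no_solution_without_psi (c : Fin 30 → ℚ) (hc : SatS c) (h1 : c 0 = 0) :
    c = 0 := by
  obtain ⟨e1, e2, e3, e4, e5, e6, _, e8, e9, e10, e11, _, _, e14, e15, e16, e17, _, _,
    e20, e21, _, e23, _, e25, _, _, e28, e29, _, e31, _, _, e34, _, e36, _, e38, e39, e40,
    e41, e42, e43, e44, _, e46, e47, e48, _⟩ := hc
  have c4 : c 4 = 0 := by linarith only [e11, e38, e2, e39, e1, h1]
  have c5 : c 5 = 0 := by linarith only [e39, h1, c4]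
  have c10 : c 10 = 0 := by linarith only [e44, e42, h1, c4]
  have c25 : c 25 = 0 := by linarith only [e46, e48, h1, c4, c5]
  have c26 : c 26 = 0 := by linarith only [e15, e36, h1, c5]
  have c17 : c 17 = 0 := by linarith only [e10, e11, e43, e20, e8, e6, e41, e16, h1, c4, c5, c10, c25, c26]
  have c1 : c 1 = 0 := by linarith only [e38, e3, e16, e11, e41, e20, e17, e40, h1, c4, c5, c10, c25, c26, c17]
  have c3 : c 3 = 0 := by linarith only [e1, c1]
  have c2 : c 2 = 0 := by linarith only [e2, c3, c5]
  have c24 : c 24 = 0 := by linarith only [e5, c2, c10]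
  have c15 : c 15 = 0 := by linarith only [e10, c2, c26]
  have c18 : c 18 = 0 := by linarith only [e28, c5, c15, c17, c26]
  have c23 : c 23 = 0 := by linarith only [e31, h1, c1, c2, c4, c5, c15, c18, c26]
  have c22 : c 22 = 0 := by linarith only [e34, h1, c2, c4, c18, c23]
  have c21 : c 21 = 0 := by linarith only [e14, c5, c15, c22]
  have c20 : c 20 = 0 := by linarith only [e43, c4, c10, c15, c23]
  have c19 : c 19 = 0 := by linarith only [e42, h1, c4, c10, c15, c20]
  have c27 : c 27 = 0 := by linarith only [e47, c4, c21, c23, c24, c26]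
  have c28 : c 28 = 0 := by linarith only [e15, c5, c26, c27]
  have c14 : c 14 = 0 := by linarith only [e23, c2, c18, c28]
  have c7 : c 7 = 0 := by linarith only [e3, c2, c14]
  have c6 : c 6 = 0 := by linarith only [e4, c7, c10]
  have c11 : c 11 = 0 := by linarith only [e6, c2, c7, c23]
  have c13 : c 13 = 0 := by linarith only [e8, c14, c17, c23]
  have c16 : c 16 = 0 := by linarith only [e9, c14, c24]
  have c8 : c 8 = 0 := by linarith only [e16, c7, c13, c20]
  have c12 : c 12 = 0 := by linarith only [e21, c2, c7, c22]
  have c9 : c 9 = 0 := by linarith only [e25, c2, c7, c14, c18]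
  have c29 : c 29 = 0 := by linarith only [e29, c2, c7, c9]
  ext i
  fin_cases i <;> assumption
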